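/- arXiv:2411.12154 — 2 statements merged into one kernel-verified Lean document; each statement's English description precedes it below -/
import Mathlib

section
/- Let (Ω, ℱ, P) be a probability space with filtration (ℱ_s)_{s≥0} and (a_s)_{s≥1} an ℝⁿ-valued adapted process with ‖a_s‖ ≤ a_max almost surely. Let D > 0, c₀ > 0, m̄_φ > 0, set c₂ = (8 n D²/m̄_φ²)(c₀ n + 1), λ = c₂, and V_t = λ I + ∑_{s=1}^{t} a_s a_sᵀ. Assume that almost surely, for every t ≥ 1: (i) ∑_{s=1}^{t} λ_min( E[a_s a_sᵀ | ℱ_{s−1}] ) ≥ D c₀ √t − c₂; and (ii) ‖ ∑_{s=1}^{t} ( E[a_s a_sᵀ | ℱ_{s−1}] − a_s a_sᵀ )² ‖ ≤ C ψ_t, where C = 256 a_max² n / c₀ and ψ_t = (D c₀/2)√t. Define F(δ) = (16 a_max⁴/(9 D² c₀²)) · (log(3n/δ))² · (768 n/c₀ + 2)². Then for every δ ∈ (0, 1) and every integer T with F(δ) ≤ T: P( ∃ t ∈ [F(δ), T] ∩ ℕ such that λ_min(V_t) ≤ (D c₀/2)√t ) ≤ δ/3. -/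
open MeasureTheory Matrix

/-- The smallest eigenvalue of a symmetric real matrix, expressed as the infimum of the
Rayleigh quotient over unit vectors. -/
noncomputable def lamMin {n : ℕ} (A : Matrix (Fin n) (Fin n) ℝ) : ℝ :=
  ⨅ v : {v : Fin n → ℝ // ∑ i, (v i) ^ 2 = 1}, v.1 ⬝ᵥ A.mulVec v.1

/-- The spectral (operator 2-) norm of a real square matrix. -/
noncomputable def specNorm {n : ℕ} (A : Matrix (Fin n) (Fin n) ℝ) : ℝ :=
  ‖Matrix.toEuclideanCLM (𝕜 := ℝ) A‖

/-- The outer product `v vᵀ` of a vector with itself, as a matrix. -/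
noncomputable def outerMat {n : ℕ} (v : EuclideanSpace ℝ (Fin n)) :
    Matrix (Fin n) (Fin n) ℝ :=
  Matrix.of fun i j => v i * v j


lemma fan_aux {θ u : ℝ} (h0 : 0 < θ) (h1 : θ < 1) (hu : -θ ≤ u) :
    θ ^ 2 * (u - Real.log (1 + u)) ≤ u ^ 2 * (-θ - Real.log (1 - θ)) := by
  let f : ℝ → ℝ := fun s => u ^ 2 * (-(s * θ) - Real.log (1 - s * θ))
    - θ ^ 2 * (s * u - Real.log (1 + s * u))
  have hp : ∀ s ∈ Set.Icc (0:ℝ) 1, 0 < 1 - s * θ ∧ 1 - s * θ ≤ 1 + s * u := by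
    intro s hs
    constructor
    · nlinarith [hs.1, hs.2]
    · nlinarith [hs.1, hs.2]
  have hd : ∀ s ∈ Set.Icc (0:ℝ) 1, HasDerivAt f (u ^ 2 * (-θ - (-θ) / (1 - s * θ))
      - θ ^ 2 * (u - u / (1 + s * u))) s := by
    intro s hs
    obtain ⟨ha, hb⟩ := hp s hs
    have e1 : HasDerivAt (fun s : ℝ => s * θ) θ s := by simpa using (hasDerivAt_id s).mul_const θ
    have e2 : HasDerivAt (fun s : ℝ => s * u) u s := by simpa using (hasDerivAt_id s).mul_const u
    have e3 := ((e1.const_sub 1).log ha.ne')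
    have e4 := ((e2.const_add 1).log (by linarith : 0 < 1 + s * u).ne')
    exact ((e1.neg.sub e3).const_mul (u ^ 2)).sub ((e2.sub e4).const_mul (θ ^ 2))
  have hm : MonotoneOn f (Set.Icc 0 1) := by
    apply monotoneOn_of_deriv_nonneg (convex_Icc 0 1)
    · exact fun s hs => (hd s hs).continuousAt.continuousWithinAt
    · intro s hs
      rw [interior_Icc] at hs
      exact (hd s (Set.Ioo_subset_Icc_self hs)).differentiableAt.differentiableWithinAt
    · intro s hs
      rw [interior_Icc] at hs
      have hs' := Set.Ioo_subset_Icc_self hs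
      rw [(hd s hs').deriv]
      obtain ⟨ha, hb⟩ := hp s hs'
      have hc : 0 < 1 + s * u := by linarith
      have : u ^ 2 * (-θ - (-θ) / (1 - s * θ)) - θ ^ 2 * (u - u / (1 + s * u))
        = u ^ 2 * θ ^ 2 * s * (1 / (1 - s * θ) - 1 / (1 + s * u)) := by
        have ha2 := mul_inv_cancel₀ ha.ne'
        have hc2 := mul_inv_cancel₀ hc.ne'
        simp only [div_eq_mul_inv]
        linear_combination u ^ 2 * θ * ha2 + θ ^ 2 * u * hc2
      rw [this]
      have h2 := one_div_le_one_div_of_le ha hb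
      have := hs.1
      apply mul_nonneg (by positivity) (by linarith)
  have := hm (Set.left_mem_Icc.2 zero_le_one) (Set.right_mem_Icc.2 zero_le_one) zero_le_one
  simp [f] at this
  linarith

lemma fan_scalar {θ b d : ℝ} (hb : 0 < b) (h0 : 0 < θ) (h1 : θ < 1) (hd : -b ≤ d) :
    Real.exp (θ / b * d - (-θ - Real.log (1 - θ)) / b ^ 2 * d ^ 2) ≤ 1 + θ / b * d := by
  have hx : -1 ≤ d / b := by rw [le_div_iff₀ hb]; linarith
  have hu : -θ ≤ θ * (d / b) := by nlinarith
  have h := fan_aux h0 h1 hu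
  have hpos : 0 < 1 + θ * (d / b) := by linarith
  have e : θ / b * d = θ * (d / b) := by ring
  have e2 : (-θ - Real.log (1 - θ)) / b ^ 2 * d ^ 2 = (d / b) ^ 2 * (-θ - Real.log (1 - θ)) := by
    field_simp
  rw [e, e2, ← Real.le_log_iff_exp_le hpos]
  have : θ ^ 2 * (θ * (d / b) - Real.log (1 + θ * (d / b))) ≤
      θ ^ 2 * ((d / b) ^ 2 * (-θ - Real.log (1 - θ))) := by
    calc _ ≤ _ := h
      _ = _ := by ring
  have := le_of_mul_le_mul_left this (by positivity)
  linarith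

lemma pade_log {y : ℝ} (hy : 0 ≤ y) : Real.log (1 + y) ≤ y * (6 + y) / (6 + 4 * y) := by
  let f : ℝ → ℝ := fun y => y * (6 + y) / (6 + 4 * y) - Real.log (1 + y)
  have hd : ∀ s ∈ Set.Ici (0:ℝ), HasDerivAt f
      (((1 * (6 + s) + s * 1) * (6 + 4 * s) - s * (6 + s) * 4) / (6 + 4 * s) ^ 2 - 1 / (1 + s)) s := by
    intro s hs
    have hs : 0 ≤ s := hs
    have e0 := hasDerivAt_id s
    have e1 : HasDerivAt (fun s : ℝ => 6 + s) 1 s := e0.const_add 6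
    have e2 : HasDerivAt (fun s : ℝ => 6 + 4 * s) 4 s := by
      simpa using (e0.const_mul 4).const_add 6
    have e3 := ((e0.const_add 1).log (by simp; positivity))
    exact ((e0.mul e1).div e2 (by positivity)).sub e3
  have hm : MonotoneOn f (Set.Ici 0) := by
    apply monotoneOn_of_deriv_nonneg (convex_Ici 0)
    · exact fun s hs => (hd s hs).continuousAt.continuousWithinAt
    · intro s hs
      exact (hd s (interior_subset hs)).differentiableAt.differentiableWithinAt
    · intro s hs
      have hs' := interior_subset hs
      rw [(hd s hs').deriv]
      have hs0 : 0 ≤ s := hs'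
      rw [sub_nonneg, div_le_div_iff₀ (by positivity) (by positivity)]
      nlinarith [pow_nonneg hs0 3]
  have := hm (Set.self_mem_Ici) (show y ∈ Set.Ici 0 from hy) hy
  simp [f] at this
  linarith

/-- the value of the exponent -/
lemma exponent_bound {x : ℝ} (hx : 0 < x) :
    1 / (2 * (x + 2 / 3)) ≤ 1 / (1 + x) -
      (-(1 / (1 + x)) - Real.log (1 - 1 / (1 + x))) * x := by
  have e : 1 - 1 / (1 + x) = (1 + 1 / x)⁻¹ := by field_simp; ring
  rw [e, Real.log_inv]
  have h := pade_log (y := 1 / x) (by positivity)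
  have h2 : x * Real.log (1 + 1 / x) ≤ x * (1 / x * (6 + 1 / x) / (6 + 4 * (1 / x))) := by gcongr
  have e2 : x * (1 / x * (6 + 1 / x) / (6 + 4 * (1 / x))) = 1 - 1 / (2 * (x + 2 / 3)) := by
    field_simp; ring
  have e3 : 1 / (1 + x) + 1 / (1 + x) * x = 1 := by field_simp
  nlinarith


section Lie
open Filter Topology NormedSpace

variable {𝔸 : Type*} [NormedRing 𝔸] [NormOneClass 𝔸]

lemma norm_pow_sub_pow_le_aux {X Y : 𝔸} {R : ℝ} (hR : 1 ≤ R) (hX : ‖X‖ ≤ R) (hY : ‖Y‖ ≤ R) (m : ℕ) :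
    ‖X ^ m - Y ^ m‖ ≤ m * R ^ m * ‖X - Y‖ := by
  induction m with
  | zero => simp
  | succ m ih =>
    have e : X ^ (m + 1) - Y ^ (m + 1) = (X ^ m - Y ^ m) * X + Y ^ m * (X - Y) := by
      rw [pow_succ, pow_succ]; noncomm_ring
    have h1 : ‖Y ^ m‖ ≤ R ^ m := (norm_pow_le Y m).trans (by gcongr)
    have hR0 : 0 ≤ R := by linarith
    calc ‖X ^ (m + 1) - Y ^ (m + 1)‖ ≤ ‖X ^ m - Y ^ m‖ * ‖X‖ + ‖Y ^ m‖ * ‖X - Y‖ := by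
          rw [e]
          exact (norm_add_le _ _).trans (add_le_add (norm_mul_le _ _) (norm_mul_le _ _))
      _ ≤ (m * R ^ m * ‖X - Y‖) * R + R ^ m * ‖X - Y‖ := by gcongr
      _ ≤ (m * R ^ m * ‖X - Y‖) * R + R ^ (m + 1) * ‖X - Y‖ := by
          gcongr
          omega
      _ = ((m + 1 : ℕ) : ℝ) * R ^ (m + 1) * ‖X - Y‖ := by push_cast; ring

lemma tendsto_pow_sub_pow [NormedAlgebra ℝ 𝔸] {f g : ℝ → 𝔸} {d : 𝔸} (hf : HasDerivAt f d 0) (hg : HasDerivAt g d 0)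
    (hf0 : f 0 = 1) (hg0 : g 0 = 1) :
    Tendsto (fun k : ℕ => f ((k : ℝ)⁻¹) ^ k - g ((k : ℝ)⁻¹) ^ k) atTop (𝓝 0) := by
  have hinv : Tendsto (fun k : ℕ => ((k : ℝ)⁻¹)) atTop (𝓝 0) := tendsto_inv_atTop_nhds_zero_nat
  set K : ℝ := ‖d‖ + 1 with hK
  have hK0 : 0 < K := by positivity
  have key : ∀ h : ℝ → 𝔸, HasDerivAt h d 0 → h 0 = 1 →
      ∀ᶠ k : ℕ in atTop, ‖h ((k : ℝ)⁻¹)‖ ≤ 1 + K * (k : ℝ)⁻¹ := by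
    intro h hh h0
    have := (hasDerivAt_iff_isLittleO.1 hh).bound (show (0:ℝ) < 1 by norm_num)
    filter_upwards [hinv.eventually this] with k hk
    rw [h0] at hk
    have e : h ((k : ℝ)⁻¹) = (h ((k : ℝ)⁻¹) - 1 - ((k : ℝ)⁻¹ - 0) • d) + 1 + ((k : ℝ)⁻¹) • d := by
      rw [sub_zero]; abel
    have hkn : (0:ℝ) ≤ (k:ℝ)⁻¹ := by positivity
    have a1 : ‖((k : ℝ)⁻¹) • d‖ = (k : ℝ)⁻¹ * ‖d‖ := by
      rw [norm_smul, Real.norm_of_nonneg hkn]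
    have a2 : ‖((k : ℝ)⁻¹ - 0)‖ = (k : ℝ)⁻¹ := by rw [sub_zero, Real.norm_of_nonneg hkn]
    rw [a2] at hk
    rw [e]
    calc _ ≤ ‖(h ((k : ℝ)⁻¹) - 1 - ((k : ℝ)⁻¹ - 0) • d)‖ + ‖(1:𝔸)‖ + ‖((k : ℝ)⁻¹) • d‖ := norm_add₃_le
      _ ≤ 1 * (k : ℝ)⁻¹ + 1 + (k : ℝ)⁻¹ * ‖d‖ := by rw [a1, norm_one]; gcongr
      _ = _ := by rw [hK]; ring
  have hsub : HasDerivAt (fun t => f t - g t) 0 0 := by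
    have := hf.sub hg
    rw [sub_self] at this
    exact this
  rw [Metric.tendsto_atTop']
  have : ∀ ε > 0, ∀ᶠ k : ℕ in atTop, dist (f ((k : ℝ)⁻¹) ^ k - g ((k : ℝ)⁻¹) ^ k) 0 < ε := by
    intro ε hε
    have hc : 0 < ε / (2 * Real.exp K) := by positivity
    have := (hasDerivAt_iff_isLittleO.1 hsub).bound hc
    filter_upwards [key f hf hf0, key g hg hg0, hinv.eventually this, eventually_gt_atTop 0] with k h1 h2 h3 hk
    have hk' : (0:ℝ) < k := by exact_mod_cast hk
    simp only [hf0, hg0, sub_self, sub_zero, smul_zero] at h3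
    rw [Real.norm_of_nonneg (by positivity : (0:ℝ) ≤ (k:ℝ)⁻¹)] at h3
    rw [dist_zero_right]
    have hR : (1 + K * (k : ℝ)⁻¹) ^ k ≤ Real.exp K := by
      have : 1 + K * (k : ℝ)⁻¹ ≤ Real.exp (K * (k : ℝ)⁻¹) := by
        linarith [Real.add_one_le_exp (K * (k : ℝ)⁻¹)]
      calc _ ≤ Real.exp (K * (k : ℝ)⁻¹) ^ k := by gcongr
        _ = _ := by rw [← Real.exp_nat_mul]; congr 1; field_simp
    calc _ ≤ k * (1 + K * (k : ℝ)⁻¹) ^ k * ‖f ((k : ℝ)⁻¹) - g ((k : ℝ)⁻¹)‖ :=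
          norm_pow_sub_pow_le_aux (by have : 0 ≤ K * (k : ℝ)⁻¹ := by positivity
                                      linarith) h1 h2 k
      _ ≤ k * Real.exp K * (ε / (2 * Real.exp K) * (k:ℝ)⁻¹) := by gcongr
      _ = ε / 2 := by field_simp
      _ < ε := by linarith
  intro ε hε
  obtain ⟨N, hN⟩ := eventually_atTop.1 (this ε hε)
  exact ⟨N, fun n hn => hN n hn.le⟩

lemma lie_product [NormedAlgebra ℝ 𝔸] [CompleteSpace 𝔸] (A B : 𝔸) :
    Tendsto (fun k : ℕ => (exp ((k : ℝ)⁻¹ • A) * exp ((k : ℝ)⁻¹ • B)) ^ k) atTop (𝓝 (exp (A + B))) := by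
  let _ : NormedAlgebra ℚ 𝔸 := NormedAlgebra.restrictScalars ℚ ℝ 𝔸
  have hA := hasDerivAt_exp_smul_const (𝕂 := ℝ) A 0
  have hB := hasDerivAt_exp_smul_const (𝕂 := ℝ) B 0
  have hAB := hasDerivAt_exp_smul_const (𝕂 := ℝ) (A + B) 0
  have h1 : HasDerivAt (fun t : ℝ => exp (t • A) * exp (t • B)) (A + B) 0 := by
    have := hA.mul hB
    simp only [zero_smul, NormedSpace.exp_zero, one_mul, mul_one] at this
    exact this
  have h2 : HasDerivAt (fun t : ℝ => exp (t • (A + B))) (A + B) 0 := by simpa using hAB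
  have h := tendsto_pow_sub_pow h1 h2 (by simp) (by simp)
  have h3 : Tendsto (fun k : ℕ => exp ((k : ℝ)⁻¹ • (A + B)) ^ k) atTop (𝓝 (exp (A + B))) := by
    apply tendsto_const_nhds.congr'
    filter_upwards [eventually_gt_atTop 0] with k hk
    have : (k : ℝ) ≠ 0 := by positivity
    rw [← NormedSpace.exp_nsmul, ← Nat.cast_smul_eq_nsmul ℝ, smul_smul, mul_inv_cancel₀ this, one_smul]
  simpa using h.add h3
end Lie

section GT
variable {n : ℕ}

def seqProd (w : ℕ → Matrix (Fin n) (Fin n) ℝ) : ℕ → Matrix (Fin n) (Fin n) ℝ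
  | 0 => 1
  | (N + 1) => seqProd w N * w N

lemma seqProd_two_mul (w : ℕ → Matrix (Fin n) (Fin n) ℝ) (N : ℕ) :
    seqProd w (2 * N) = seqProd (fun i => w (2 * i) * w (2 * i + 1)) N := by
  induction N with
  | zero => rfl
  | succ N ih =>
    rw [show 2 * (N + 1) = 2 * N + 1 + 1 by ring]
    simp only [seqProd, ih, Matrix.mul_assoc]

lemma seqProd_const (A : Matrix (Fin n) (Fin n) ℝ) (N : ℕ) : seqProd (fun _ => A) N = A ^ N := by
  induction N with
  | zero => rfl
  | succ N ih => rw [seqProd, ih, pow_succ]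

lemma trace_mul_pow_comm (X Y : Matrix (Fin n) (Fin n) ℝ) (m : ℕ) :
    ((X * Y) ^ m).trace = ((Y * X) ^ m).trace := by
  cases m with
  | zero => simp
  | succ m =>
    have : (X * Y) ^ (m + 1) = X * ((Y * X) ^ m * Y) := by
      induction m with
      | zero => simp
      | succ m ih =>
        rw [pow_succ, ih, pow_succ]
        simp only [Matrix.mul_assoc]
    rw [this, Matrix.trace_mul_comm, pow_succ, Matrix.mul_assoc]

lemma trace_mul_transpose_nonneg (A : Matrix (Fin n) (Fin n) ℝ) : 0 ≤ (A * Aᵀ).trace := by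
  simp only [Matrix.trace, Matrix.diag, Matrix.mul_apply, Matrix.transpose_apply]
  exact Finset.sum_nonneg fun i _ => Finset.sum_nonneg fun j _ => mul_self_nonneg _

lemma trace_seqProd_le (k : ℕ) : ∀ (c : ℝ) (w : ℕ → Matrix (Fin n) (Fin n) ℝ),
    (∀ i, ((w i * (w i)ᵀ) ^ (2 ^ k)).trace ≤ c) → (seqProd w (2 ^ (k + 1))).trace ≤ c := by
  induction k with
  | zero =>
    intro c w h
    have h0 := h 0
    have h1 := h 1
    simp only [pow_zero, pow_one] at h0 h1
    have e : seqProd w (2 ^ (0 + 1)) = w 0 * w 1 := by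
      simp [seqProd]
    rw [e]
    have hn := trace_mul_transpose_nonneg (w 0 - (w 1)ᵀ)
    rw [Matrix.transpose_sub, Matrix.transpose_transpose, Matrix.sub_mul, Matrix.mul_sub, Matrix.mul_sub,
      Matrix.trace_sub, Matrix.trace_sub, Matrix.trace_sub,
      Matrix.trace_mul_comm (w 1)ᵀ (w 1), ← Matrix.transpose_mul, Matrix.trace_transpose] at hn
    linarith
  | succ k ih =>
    intro c w h
    rw [show 2 ^ (k + 1 + 1) = 2 * 2 ^ (k + 1) by ring, seqProd_two_mul]
    apply ih
    intro i
    set A := w (2 * i)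
    set B := w (2 * i + 1)
    have hA : ((A * Aᵀ) ^ (2 ^ (k + 1))).trace ≤ c := h (2 * i)
    have hB : ((B * Bᵀ) ^ (2 ^ (k + 1))).trace ≤ c := h (2 * i + 1)
    have e1 : A * B * (A * B)ᵀ = A * (B * Bᵀ * Aᵀ) := by
      rw [Matrix.transpose_mul]; simp only [Matrix.mul_assoc]
    rw [e1, trace_mul_pow_comm, Matrix.mul_assoc]
    let w' : ℕ → Matrix (Fin n) (Fin n) ℝ := fun j => if Even j then B * Bᵀ else Aᵀ * A
    have e2 : seqProd w' (2 ^ (k + 1)) = (B * Bᵀ * (Aᵀ * A)) ^ (2 ^ k) := by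
      rw [show 2 ^ (k + 1) = 2 * 2 ^ k by ring, seqProd_two_mul, ← seqProd_const]
      congr 1
      funext j
      simp [w']
    rw [← e2]
    apply ih
    intro j
    by_cases hj : Even j
    · simp only [w', if_pos hj, Matrix.transpose_mul, Matrix.transpose_transpose]
      rw [← pow_two, ← pow_mul, ← pow_succ']
      exact hB
    · simp only [w', if_neg hj, Matrix.transpose_mul, Matrix.transpose_transpose]
      rw [← pow_two, ← pow_mul, ← pow_succ', trace_mul_pow_comm]
      exact hA

lemma trace_pow_le (k : ℕ) : ∀ (P Q : Matrix (Fin n) (Fin n) ℝ), Pᵀ = P → Qᵀ = Q →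
    ((P * Q) ^ (2 ^ k)).trace ≤ (P ^ (2 ^ k) * Q ^ (2 ^ k)).trace := by
  induction k with
  | zero => intro P Q _ _; simp
  | succ k ih =>
    intro P Q hP hQ
    have h1 : ((P * Q) ^ (2 ^ (k + 1))).trace ≤ ((P * Q * (P * Q)ᵀ) ^ (2 ^ k)).trace := by
      rw [← seqProd_const]
      exact trace_seqProd_le k _ _ fun _ => le_rfl
    have h2 : ((P * Q * (P * Q)ᵀ) ^ (2 ^ k)).trace = ((P ^ 2 * Q ^ 2) ^ (2 ^ k)).trace := by
      rw [Matrix.transpose_mul, hP, hQ, Matrix.mul_assoc, trace_mul_pow_comm, ← Matrix.mul_assoc,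
        Matrix.mul_assoc _ P P, trace_mul_pow_comm, pow_two, pow_two]
    have h3 := ih (P ^ 2) (Q ^ 2) (by rw [Matrix.transpose_pow, hP]) (by rw [Matrix.transpose_pow, hQ])
    rw [← pow_mul, ← pow_mul, ← pow_succ'] at h3
    linarith

open scoped Matrix.Norms.Operator in
open Filter Topology in
lemma golden_thompson [NeZero n] (A B : Matrix (Fin n) (Fin n) ℝ) (hA : Aᵀ = A) (hB : Bᵀ = B) :
    (NormedSpace.exp (A + B)).trace ≤ (NormedSpace.exp A * NormedSpace.exp B).trace := by
  have h := (lie_product A B).comp (tendsto_pow_atTop_atTop_of_one_lt (r := 2) (by norm_num))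
  have h2 : Tendsto (fun k : ℕ => (((NormedSpace.exp ((((2 ^ k : ℕ)) : ℝ)⁻¹ • A) *
      NormedSpace.exp ((((2 ^ k : ℕ)) : ℝ)⁻¹ • B)) ^ (2 ^ k)).trace)) atTop
      (𝓝 ((NormedSpace.exp (A + B)).trace)) :=
    ((Continuous.matrix_trace continuous_id).tendsto _).comp h
  refine le_of_tendsto' h2 fun k => ?_
  have hs : ∀ M : Matrix (Fin n) (Fin n) ℝ, Mᵀ = M → ∀ r : ℝ,
      (NormedSpace.exp (r • M))ᵀ = NormedSpace.exp (r • M) := by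
    intro M hM r
    rw [← Matrix.exp_transpose, Matrix.transpose_smul, hM]
  have hp : ∀ M : Matrix (Fin n) (Fin n) ℝ,
      (NormedSpace.exp ((((2 ^ k : ℕ)) : ℝ)⁻¹ • M)) ^ (2 ^ k) = NormedSpace.exp M := by
    intro M
    rw [← Matrix.exp_nsmul, ← Nat.cast_smul_eq_nsmul ℝ, smul_smul, mul_inv_cancel₀ (by positivity), one_smul]
  have := trace_pow_le k _ _ (hs A hA (((2 ^ k : ℕ)) : ℝ)⁻¹) (hs B hB (((2 ^ k : ℕ)) : ℝ)⁻¹)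
  rwa [hp, hp] at this
end GT

section Mat
variable {n : ℕ}

lemma symm_diag (A : Matrix (Fin n) (Fin n) ℝ) (hA : Aᵀ = A) :
    ∃ (U : Matrix (Fin n) (Fin n) ℝ) (d : Fin n → ℝ), U * Uᵀ = 1 ∧ Uᵀ * U = 1 ∧
      A = U * diagonal d * Uᵀ := by
  have hH : A.IsHermitian := by
    rw [Matrix.IsHermitian, Matrix.conjTranspose_eq_transpose_of_trivial, hA]
  refine ⟨hH.eigenvectorUnitary, hH.eigenvalues, ?_, ?_, ?_⟩
  · have := Unitary.coe_mul_star_self hH.eigenvectorUnitary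
    rwa [Unitary.coe_star, Matrix.star_eq_conjTranspose, Matrix.conjTranspose_eq_transpose_of_trivial] at this
  · have := Unitary.coe_star_mul_self hH.eigenvectorUnitary
    rwa [Matrix.star_eq_conjTranspose, Matrix.conjTranspose_eq_transpose_of_trivial] at this
  · have := hH.spectral_theorem
    rw [Unitary.conjStarAlgAut_apply, Matrix.star_eq_conjTranspose,
      Matrix.conjTranspose_eq_transpose_of_trivial] at this
    exact this

lemma exp_diag_conj (U : Matrix (Fin n) (Fin n) ℝ) (d : Fin n → ℝ) (h1 : U * Uᵀ = 1) :
    NormedSpace.exp (U * diagonal d * Uᵀ) = U * diagonal (fun i => Real.exp (d i)) * Uᵀ := by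
  have hinv : U⁻¹ = Uᵀ := Matrix.inv_eq_right_inv h1
  have hu : IsUnit U := IsUnit.of_mul_eq_one _ h1
  rw [← hinv, Matrix.exp_conj _ _ hu, Matrix.exp_diagonal]
  congr 3
  funext i
  rw [Pi.coe_exp, Real.exp_eq_exp_ℝ]

lemma quad_diag (U : Matrix (Fin n) (Fin n) ℝ) (d : Fin n → ℝ) (v : Fin n → ℝ) :
    v ⬝ᵥ (U * diagonal d * Uᵀ).mulVec v = ∑ i, (Uᵀ.mulVec v i) ^ 2 * d i := by
  rw [← Matrix.mulVec_mulVec, ← Matrix.mulVec_mulVec, Matrix.dotProduct_mulVec,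
    ← Matrix.mulVec_transpose]
  simp only [dotProduct, Matrix.mulVec_diagonal]
  exact Finset.sum_congr rfl fun i _ => by ring

lemma trace_exp_eq (U : Matrix (Fin n) (Fin n) ℝ) (d : Fin n → ℝ) (h1 : U * Uᵀ = 1) (h2 : Uᵀ * U = 1) :
    (NormedSpace.exp (U * diagonal d * Uᵀ)).trace = ∑ i, Real.exp (d i) := by
  rw [exp_diag_conj U d h1, Matrix.trace_mul_comm, ← Matrix.mul_assoc, h2, Matrix.one_mul,
    Matrix.trace_diagonal]

lemma trace_exp_nonneg (A : Matrix (Fin n) (Fin n) ℝ) (hA : Aᵀ = A) :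
    0 ≤ (NormedSpace.exp A).trace := by
  obtain ⟨U, d, h1, h2, rfl⟩ := symm_diag A hA
  rw [trace_exp_eq U d h1 h2]
  exact Finset.sum_nonneg fun i _ => (Real.exp_pos _).le

lemma exp_quad_le_trace_exp (A : Matrix (Fin n) (Fin n) ℝ) (hA : Aᵀ = A) (v : Fin n → ℝ)
    (hv : ∑ i, v i ^ 2 = 1) : Real.exp (v ⬝ᵥ A.mulVec v) ≤ (NormedSpace.exp A).trace := by
  obtain ⟨U, d, h1, h2, rfl⟩ := symm_diag A hA
  rw [trace_exp_eq U d h1 h2, quad_diag]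
  have hw : ∑ i, (Uᵀ.mulVec v i) ^ 2 = 1 := by
    have := quad_diag U (fun _ => 1) v
    rw [show diagonal (fun _ : Fin n => (1:ℝ)) = 1 from Matrix.diagonal_one, Matrix.mul_one, h1,
      Matrix.one_mulVec] at this
    simp only [mul_one] at this
    rw [← this, ← hv]
    simp [dotProduct, pow_two]
  have hj := convexOn_exp.map_sum_le (t := Finset.univ) (w := fun i => (Uᵀ.mulVec v i) ^ 2) (p := d)
    (fun i _ => sq_nonneg _) hw (fun i _ => Set.mem_univ _)
  simp only [smul_eq_mul] at hj
  refine hj.trans (Finset.sum_le_sum fun i _ => ?_)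
  have : (Uᵀ.mulVec v i) ^ 2 ≤ 1 := by
    rw [← hw]
    exact Finset.single_le_sum (f := fun i => (Uᵀ.mulVec v i) ^ 2) (fun i _ => sq_nonneg _) (Finset.mem_univ i)
  nlinarith [Real.exp_pos (d i)]

lemma trace_step [NeZero n] (H X : Matrix (Fin n) (Fin n) ℝ) (hH : Hᵀ = H) (hX : Xᵀ = X)
    {θ b : ℝ} (hb : 0 < b) (h0 : 0 < θ) (h1 : θ < 1)
    (hXb : ∀ v : Fin n → ℝ, ∑ i, v i ^ 2 = 1 → -b ≤ v ⬝ᵥ X.mulVec v) :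
    (NormedSpace.exp (H + ((θ / b) • X - ((-θ - Real.log (1 - θ)) / b ^ 2) • X ^ 2))).trace ≤
      (NormedSpace.exp H * (1 + (θ / b) • X)).trace := by
  set α := θ / b
  set β := (-θ - Real.log (1 - θ)) / b ^ 2
  have hZ : (α • X - β • X ^ 2)ᵀ = α • X - β • X ^ 2 := by
    rw [Matrix.transpose_sub, Matrix.transpose_smul, Matrix.transpose_smul, Matrix.transpose_pow, hX]
  refine (golden_thompson _ _ hH hZ).trans ?_
  obtain ⟨U, d, hU1, hU2, hXd⟩ := symm_diag X hX
  have hX2 : X ^ 2 = U * diagonal (fun i => d i ^ 2) * Uᵀ := by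
    rw [hXd, pow_two]
    calc U * diagonal d * Uᵀ * (U * diagonal d * Uᵀ) = U * diagonal d * (Uᵀ * U) * diagonal d * Uᵀ := by
          simp only [Matrix.mul_assoc]
      _ = _ := by
          rw [hU2, Matrix.mul_one, Matrix.mul_assoc U, Matrix.diagonal_mul_diagonal]
          simp only [pow_two]
  have hlin : ∀ (r : ℝ) (e : Fin n → ℝ), r • (U * diagonal e * Uᵀ) = U * diagonal (r • e) * Uᵀ := by
    intro r e
    rw [Matrix.diagonal_smul, Matrix.mul_smul, Matrix.smul_mul]
  have hZd : α • X - β • X ^ 2 = U * diagonal (α • d - β • (fun i => d i ^ 2)) * Uᵀ := by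
    rw [hX2, hlin]
    nth_rewrite 1 [hXd]
    rw [hlin, ← Matrix.sub_mul, ← Matrix.mul_sub, Matrix.diagonal_sub]
    rfl
  set k : Fin n → ℝ := fun i => 1 + α * d i - Real.exp (α * d i - β * d i ^ 2)
  have hk : 1 + α • X - NormedSpace.exp (α • X - β • X ^ 2) = U * diagonal k * Uᵀ := by
    rw [hZd, exp_diag_conj U _ hU1]
    nth_rewrite 1 [hXd]
    have e1 : (1 : Matrix (Fin n) (Fin n) ℝ) = U * diagonal (fun _ => 1) * Uᵀ := by
      rw [show diagonal (fun _ : Fin n => (1:ℝ)) = 1 from Matrix.diagonal_one, Matrix.mul_one, hU1]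
    rw [hlin, e1, ← Matrix.add_mul, ← Matrix.mul_add, ← Matrix.sub_mul, ← Matrix.mul_sub,
      Matrix.diagonal_add, Matrix.diagonal_sub]
    rfl
  have hd : ∀ i, -b ≤ d i := by
    intro i
    have hw : Uᵀ.mulVec (U.mulVec (Pi.single i 1)) = Pi.single i 1 := by
      rw [Matrix.mulVec_mulVec, hU2, Matrix.one_mulVec]
    have hn : ∑ j, (U.mulVec (Pi.single i 1)) j ^ 2 = 1 := by
      have := quad_diag U (fun _ => 1) (U.mulVec (Pi.single i 1))
      rw [show diagonal (fun _ : Fin n => (1:ℝ)) = 1 from Matrix.diagonal_one, Matrix.mul_one, hU1,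
        Matrix.one_mulVec, hw] at this
      simp only [dotProduct, ← pow_two] at this
      rw [this]
      simp [Pi.single_apply]
    have := hXb _ hn
    rw [hXd, quad_diag, hw] at this
    simpa [Pi.single_apply] using this
  have hknn : ∀ i, 0 ≤ k i := fun i => sub_nonneg.2 (fan_scalar hb h0 h1 (hd i))
  rw [← sub_nonneg, ← Matrix.trace_sub, ← Matrix.mul_sub, hk]
  set S := NormedSpace.exp ((1 / 2 : ℝ) • H)
  have hS : NormedSpace.exp H = Sᵀ * S := by
    have hSt : Sᵀ = S := by
      rw [← Matrix.exp_transpose, Matrix.transpose_smul, hH]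
    rw [hSt, ← pow_two, ← Matrix.exp_nsmul, ← Nat.cast_smul_eq_nsmul ℝ, smul_smul]
    norm_num
  rw [hS, Matrix.mul_assoc, Matrix.trace_mul_comm]
  have : S * (U * diagonal k * Uᵀ) * Sᵀ = (S * U) * diagonal k * (S * U)ᵀ := by
    rw [Matrix.transpose_mul]; simp only [Matrix.mul_assoc]
  rw [this]
  simp only [Matrix.trace, Matrix.diag, Matrix.mul_apply (N := (S * U)ᵀ), Matrix.mul_diagonal, Matrix.transpose_apply]
  refine Finset.sum_nonneg fun i _ => Finset.sum_nonneg fun j _ => ?_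
  have := mul_nonneg (mul_self_nonneg ((S * U) i j)) (hknn j)
  linarith

end Mat

section Maxi

lemma maximal_super {Ω : Type*} {mΩ : MeasurableSpace Ω} (μ : Measure Ω) [IsProbabilityMeasure μ]
    (ℱ : Filtration ℕ mΩ) (f : ℕ → Ω → ℝ) (hm : ∀ t, StronglyMeasurable[ℱ t] (f t))
    (hint : ∀ t, Integrable (f t) μ) (hnn : ∀ t ω, 0 ≤ f t ω)
    (hsup : ∀ t, ∀ S, MeasurableSet[ℱ t] S → ∫ ω in S, f (t + 1) ω ∂μ ≤ ∫ ω in S, f t ω ∂μ)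
    (c : ℝ) (T : ℕ) :
    c * μ.real {ω | ∃ t, t ≤ T ∧ c ≤ f t ω} ≤ ∫ ω, f 0 ω ∂μ := by
  have hms : ∀ t, MeasurableSet[ℱ t] {ω | f t ω < c} := fun t =>
    (hm t).measurable measurableSet_Iio
  let A : ℕ → Set Ω := fun t => {ω | ∀ s, s ≤ t → f s ω < c}
  have hA : ∀ t, MeasurableSet[ℱ t] (A t) := by
    intro t
    have : A t = ⋂ s, ⋂ (_ : s ≤ t), {ω | f s ω < c} := by ext; simp [A]
    rw [this]
    exact MeasurableSet.iInter fun s => MeasurableSet.iInter fun hs => ℱ.mono hs _ (hms s)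
  have hA' : ∀ t, MeasurableSet (A t) := fun t => ℱ.le t _ (hA t)
  have key : ∀ t, c * μ.real (A t)ᶜ + ∫ ω in A t, f t ω ∂μ ≤ ∫ ω, f 0 ω ∂μ := by
    intro t
    induction t with
    | zero =>
      rw [← integral_add_compl (hA' 0) (hint 0)]
      have : c * μ.real (A 0)ᶜ ≤ ∫ ω in (A 0)ᶜ, f 0 ω ∂μ := by
        apply setIntegral_ge_of_const_le_real (hA' 0).compl (measure_ne_top _ _) _ (hint 0).integrableOn
        intro ω hω
        simpa [A] using hω
      linarith
    | succ t ih =>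
      have hsub : A (t + 1) ⊆ A t := fun ω hω s hs => hω s (by omega)
      have hB : MeasurableSet (A t \ A (t + 1)) := (hA' t).diff (hA' (t + 1))
      have e1 : ∫ ω in A t, f (t + 1) ω ∂μ =
          ∫ ω in A t \ A (t + 1), f (t + 1) ω ∂μ + ∫ ω in A (t + 1), f (t + 1) ω ∂μ := by
        rw [← setIntegral_union Set.disjoint_sdiff_left (hA' (t + 1)) (hint _).integrableOn
          (hint _).integrableOn, Set.sdiff_union_of_subset hsub]
      have e2 : μ.real (A (t + 1))ᶜ = μ.real (A t)ᶜ + μ.real (A t \ A (t + 1)) := by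
        rw [← measureReal_union _ hB]
        · congr 1
          ext ω
          have := @hsub ω
          simp only [Set.mem_compl_iff, Set.mem_union, Set.mem_sdiff]
          tauto
        · rw [Set.disjoint_left]
          intro ω h1 h2
          exact h1 h2.1
      have e3 : c * μ.real (A t \ A (t + 1)) ≤ ∫ ω in A t \ A (t + 1), f (t + 1) ω ∂μ := by
        apply setIntegral_ge_of_const_le_real hB (measure_ne_top _ _) _ (hint _).integrableOn
        rintro ω ⟨h1, h2⟩
        by_contra h3
        apply h2
        intro s hs
        rcases Nat.le_succ_iff.1 hs with h | h
        · exact h1 s h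
        · subst h; exact not_le.1 h3
      have := hsup t (A t) (hA t)
      rw [e2]
      linarith
  have e : {ω | ∃ t, t ≤ T ∧ c ≤ f t ω} = (A T)ᶜ := by
    ext ω
    simp [A]
  rw [e]
  have := key T
  have h2 : 0 ≤ ∫ ω in A T, f T ω ∂μ := setIntegral_nonneg (hA' T) fun ω _ => hnn T ω
  linarith

lemma setIntegral_mul_condExp_sub {Ω : Type*} {m mΩ : MeasurableSpace Ω} (μ : Measure Ω) [IsProbabilityMeasure μ]
    (hle : m ≤ mΩ) (g f : Ω → ℝ) (hg : StronglyMeasurable[m] g) {K : ℝ} (hgb : ∀ᵐ ω ∂μ, |g ω| ≤ K)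
    (hf : Integrable f μ) (S : Set Ω) (hS : MeasurableSet[m] S) :
    Integrable (fun ω => g ω * ((μ[f | m]) ω - f ω)) μ ∧
    ∫ ω in S, g ω * ((μ[f | m]) ω - f ω) ∂μ = 0 := by
  have hg' : AEStronglyMeasurable g μ := (hg.mono hle).aestronglyMeasurable
  have h1 : Integrable (fun ω => g ω * f ω) μ := hf.bdd_mul hg' hgb
  have h2 : Integrable (fun ω => g ω * (μ[f | m]) ω) μ := integrable_condExp.bdd_mul hg' hgb
  have e : (fun ω => g ω * ((μ[f | m]) ω - f ω)) = fun ω => g ω * (μ[f | m]) ω - g ω * f ω := by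
    funext ω; ring
  rw [e]
  refine ⟨h2.sub h1, ?_⟩
  rw [integral_sub h2.integrableOn h1.integrableOn]
  have h3 : μ[fun ω => g ω * f ω | m] =ᵐ[μ] fun ω => g ω * (μ[f | m]) ω :=
    condExp_mul_of_stronglyMeasurable_left hg h1 hf
  rw [← setIntegral_condExp hle h1 hS, sub_eq_zero]
  exact (setIntegral_congr_ae (hle _ hS) (h3.mono fun ω h _ => h)).symm

end Maxi

section Proc
variable {n : ℕ} {Ω : Type*} {mΩ : MeasurableSpace Ω}

noncomputable def cE (μ : Measure Ω) (ℱ : Filtration ℕ mΩ)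
    (a : ℕ → Ω → EuclideanSpace ℝ (Fin n)) (s : ℕ) (ω : Ω) : Matrix (Fin n) (Fin n) ℝ :=
  Matrix.of fun i j => (μ[(fun ω' => a s ω' i * a s ω' j) | ℱ (s - 1)]) ω

noncomputable def Xp (μ : Measure Ω) (ℱ : Filtration ℕ mΩ)
    (a : ℕ → Ω → EuclideanSpace ℝ (Fin n)) (s : ℕ) (ω : Ω) : Matrix (Fin n) (Fin n) ℝ :=
  cE μ ℱ a s ω - outerMat (a s ω)

noncomputable def Hp (μ : Measure Ω) (ℱ : Filtration ℕ mΩ)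
    (a : ℕ → Ω → EuclideanSpace ℝ (Fin n)) (α β : ℝ) (t : ℕ) (ω : Ω) : Matrix (Fin n) (Fin n) ℝ :=
  ∑ s ∈ Finset.Icc 1 t, (α • Xp μ ℱ a s ω - β • Xp μ ℱ a s ω ^ 2)

variable (μ : Measure Ω) [IsProbabilityMeasure μ] (ℱ : Filtration ℕ mΩ)
    (a : ℕ → Ω → EuclideanSpace ℝ (Fin n))

omit [IsProbabilityMeasure μ] in
lemma Xp_symm (s : ℕ) (ω : Ω) : (Xp μ ℱ a s ω)ᵀ = Xp μ ℱ a s ω := by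
  ext i j
  simp only [Xp, cE, outerMat, Matrix.transpose_apply, Matrix.sub_apply, Matrix.of_apply]
  rw [mul_comm]
  congr 3
  funext ω'
  rw [mul_comm]

omit [IsProbabilityMeasure μ] in
lemma Hp_symm (α β : ℝ) (t : ℕ) (ω : Ω) : (Hp μ ℱ a α β t ω)ᵀ = Hp μ ℱ a α β t ω := by
  rw [Hp, Matrix.transpose_sum]
  refine Finset.sum_congr rfl fun s _ => ?_
  rw [Matrix.transpose_sub, Matrix.transpose_smul, Matrix.transpose_smul, Matrix.transpose_pow,
    Xp_symm]

variable (hameas : ∀ s, StronglyMeasurable[ℱ s] (a s)) (amax : ℝ)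
    (hanorm : ∀ s, ∀ᵐ ω ∂μ, ‖a s ω‖ ≤ amax)

include hanorm in
omit [IsProbabilityMeasure μ] in
lemma prod_bound (s : ℕ) (i j : Fin n) : ∀ᵐ ω ∂μ, |a s ω i * a s ω j| ≤ amax ^ 2 := by
  filter_upwards [hanorm s] with ω hω
  rw [abs_mul, pow_two]
  have h1 := PiLp.norm_apply_le (a s ω) i
  have h2 := PiLp.norm_apply_le (a s ω) j
  rw [Real.norm_eq_abs] at h1 h2
  exact mul_le_mul (h1.trans hω) (h2.trans hω) (abs_nonneg _) ((norm_nonneg _).trans hω)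

include hameas in
omit [IsProbabilityMeasure μ] in
lemma coord_meas (s : ℕ) (i : Fin n) : StronglyMeasurable[ℱ s] (fun ω => a s ω i) :=
  (EuclideanSpace.proj (𝕜 := ℝ) i).continuous.comp_stronglyMeasurable (hameas s)

include hameas in
omit [IsProbabilityMeasure μ] in
lemma prod_meas (s : ℕ) (i j : Fin n) : StronglyMeasurable[ℱ s] (fun ω => a s ω i * a s ω j) :=
  (coord_meas ℱ a hameas s i).mul (coord_meas ℱ a hameas s j)

include hameas hanorm in
lemma prod_int (s : ℕ) (i j : Fin n) : Integrable (fun ω => a s ω i * a s ω j) μ :=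
  Integrable.of_bound ((prod_meas ℱ a hameas s i j).mono (ℱ.le s)).aestronglyMeasurable (amax ^ 2)
    (prod_bound μ a amax hanorm s i j)

include hameas hanorm in
lemma cE_psd (s : ℕ) : ∀ᵐ ω ∂μ, ∀ v : Fin n → ℝ, 0 ≤ v ⬝ᵥ (cE μ ℱ a s ω).mulVec v := by
  have h1 : ∀ v : Fin n → ℝ, ∀ᵐ ω ∂μ, 0 ≤ v ⬝ᵥ (cE μ ℱ a s ω).mulVec v := by
    intro v
    have e : (∑ p : Fin n × Fin n, (v p.1 * v p.2) • (fun ω => a s ω p.1 * a s ω p.2))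
        = fun ω => (∑ i, v i * a s ω i) ^ 2 := by
      funext ω
      rw [Finset.sum_apply, pow_two, Finset.sum_mul_sum, ← Finset.sum_product']
      simp only [Finset.univ_product_univ, Pi.smul_apply, smul_eq_mul]
      exact Finset.sum_congr rfl fun p _ => by ring
    have h2 := condExp_finsetSum (μ := μ) (s := (Finset.univ : Finset (Fin n × Fin n)))
      (f := fun p => (v p.1 * v p.2) • (fun ω => a s ω p.1 * a s ω p.2))
      (fun p _ => (prod_int μ ℱ a hameas amax hanorm s p.1 p.2).smul _) (ℱ (s - 1))
    have h3 : ∀ᵐ ω ∂μ, ∀ p : Fin n × Fin n,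
        (μ[(v p.1 * v p.2) • (fun ω => a s ω p.1 * a s ω p.2) | ℱ (s - 1)]) ω =
        ((v p.1 * v p.2) • μ[(fun ω => a s ω p.1 * a s ω p.2) | ℱ (s - 1)]) ω :=
      ae_all_iff.2 fun p => condExp_smul _ _ _
    have h4 : 0 ≤ᵐ[μ] μ[(fun ω => (∑ i, v i * a s ω i) ^ 2) | ℱ (s - 1)] :=
      condExp_nonneg (Filter.Eventually.of_forall fun ω => sq_nonneg _)
    rw [e] at h2
    filter_upwards [h2, h3, h4] with ω e2 e3 e4
    rw [e2, Finset.sum_apply, Finset.sum_congr rfl fun p _ => e3 p] at e4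
    simp only [Pi.zero_apply, Pi.smul_apply, smul_eq_mul] at e4
    convert e4 using 1
    simp only [dotProduct, Matrix.mulVec, cE, Matrix.of_apply, Finset.mul_sum]
    rw [← Finset.sum_product', Finset.univ_product_univ]
    exact Finset.sum_congr rfl fun p _ => by ring
  have h5 : ∀ᵐ ω ∂μ, ∀ k : ℕ, 0 ≤ (TopologicalSpace.denseSeq (Fin n → ℝ) k) ⬝ᵥ
      (cE μ ℱ a s ω).mulVec (TopologicalSpace.denseSeq (Fin n → ℝ) k) := ae_all_iff.2 fun k => h1 _
  filter_upwards [h5] with ω hω v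
  refine (TopologicalSpace.denseRange_denseSeq (Fin n → ℝ)).induction_on
    (p := fun v => 0 ≤ v ⬝ᵥ (cE μ ℱ a s ω).mulVec v) v ?_ hω
  apply isClosed_le continuous_const
  exact Continuous.dotProduct continuous_id (Continuous.matrix_mulVec continuous_const continuous_id)

include hameas hanorm in
lemma Xp_lower (s : ℕ) : ∀ᵐ ω ∂μ, ∀ v : Fin n → ℝ, ∑ i, v i ^ 2 = 1 →
    -amax ^ 2 ≤ v ⬝ᵥ (Xp μ ℱ a s ω).mulVec v := by
  filter_upwards [cE_psd μ ℱ a hameas amax hanorm s, hanorm s] with ω h1 h2 v hv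
  have e : v ⬝ᵥ (outerMat (a s ω)).mulVec v = (∑ i, v i * a s ω i) ^ 2 := by
    simp only [dotProduct, Matrix.mulVec, outerMat, Matrix.of_apply]
    rw [pow_two, Finset.sum_mul_sum]
    refine Finset.sum_congr rfl fun i _ => ?_
    rw [Finset.mul_sum]
    exact Finset.sum_congr rfl fun j _ => by ring
  have h3 := Finset.sum_mul_sq_le_sq_mul_sq Finset.univ v (a s ω)
  rw [hv, one_mul, ← EuclideanSpace.real_norm_sq_eq] at h3
  have h4 : ‖a s ω‖ ^ 2 ≤ amax ^ 2 := by gcongr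
  have h5 := h1 v
  rw [Xp, Matrix.sub_mulVec, dotProduct_sub, e]
  linarith

/-- a.e. entrywise boundedness -/
def AEB (f : Ω → Matrix (Fin n) (Fin n) ℝ) : Prop := ∃ K : ℝ, ∀ᵐ ω ∂μ, ∀ i j, |f ω i j| ≤ K

omit [IsProbabilityMeasure μ] in
lemma AEB.sub {f g : Ω → Matrix (Fin n) (Fin n) ℝ} (hf : AEB μ f) (hg : AEB μ g) :
    AEB μ (fun ω => f ω - g ω) := by
  obtain ⟨K, hK⟩ := hf
  obtain ⟨L, hL⟩ := hg
  refine ⟨K + L, ?_⟩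
  filter_upwards [hK, hL] with ω h1 h2 i j
  exact (abs_sub _ _).trans (add_le_add (h1 i j) (h2 i j))

omit [IsProbabilityMeasure μ] in
lemma AEB.smul {f : Ω → Matrix (Fin n) (Fin n) ℝ} (hf : AEB μ f) (r : ℝ) :
    AEB μ (fun ω => r • f ω) := by
  obtain ⟨K, hK⟩ := hf
  refine ⟨|r| * K, ?_⟩
  filter_upwards [hK] with ω h1 i j
  rw [Matrix.smul_apply, smul_eq_mul, abs_mul]
  exact mul_le_mul_of_nonneg_left (h1 i j) (abs_nonneg _)

omit [IsProbabilityMeasure μ] in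
lemma AEB.sq {f : Ω → Matrix (Fin n) (Fin n) ℝ} (hf : AEB μ f) :
    AEB μ (fun ω => f ω ^ 2) := by
  obtain ⟨K, hK⟩ := hf
  refine ⟨∑ _k : Fin n, K * K, ?_⟩
  filter_upwards [hK] with ω h1 i j
  rw [pow_two, Matrix.mul_apply]
  refine (Finset.abs_sum_le_sum_abs _ _).trans (Finset.sum_le_sum fun k _ => ?_)
  rw [abs_mul]
  exact mul_le_mul (h1 i k) (h1 k j) (abs_nonneg _) ((abs_nonneg _).trans (h1 i k))

omit [IsProbabilityMeasure μ] in
lemma AEB.sum {f : ℕ → Ω → Matrix (Fin n) (Fin n) ℝ} (S : Finset ℕ) (hf : ∀ s, AEB μ (f s)) :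
    AEB μ (fun ω => ∑ s ∈ S, f s ω) := by
  choose K hK using hf
  refine ⟨∑ s ∈ S, K s, ?_⟩
  filter_upwards [ae_all_iff.2 hK] with ω h1 i j
  rw [Matrix.sum_apply]
  exact (Finset.abs_sum_le_sum_abs _ _).trans (Finset.sum_le_sum fun s _ => h1 s i j)

lemma exp_cont : Continuous (NormedSpace.exp : Matrix (Fin n) (Fin n) ℝ → Matrix (Fin n) (Fin n) ℝ) := by
  open scoped Matrix.Norms.Operator in
  let _ : NormedAlgebra ℚ (Matrix (Fin n) (Fin n) ℝ) := NormedAlgebra.restrictScalars ℚ ℝ _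
  exact NormedSpace.exp_continuous

omit [IsProbabilityMeasure μ] in
lemma AEB.exp {f : Ω → Matrix (Fin n) (Fin n) ℝ} (hf : AEB μ f) :
    AEB μ (fun ω => NormedSpace.exp (f ω)) := by
  obtain ⟨K, hK⟩ := hf
  have hc : IsCompact (Set.univ.pi fun _ : Fin n => Set.univ.pi fun _ : Fin n => Set.Icc (-K) K) :=
    isCompact_univ_pi fun _ => isCompact_univ_pi fun _ => isCompact_Icc
  have hb : ∀ i j : Fin n, ∃ C : ℝ, ∀ A : Matrix (Fin n) (Fin n) ℝ, (∀ i j, |A i j| ≤ K) →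
      |NormedSpace.exp A i j| ≤ C := by
    intro i j
    have hcont : Continuous fun A : Matrix (Fin n) (Fin n) ℝ => NormedSpace.exp A i j :=
      exp_cont.matrix_elem i j
    obtain ⟨C, hC⟩ := hc.exists_bound_of_continuousOn (f := fun A : Fin n → Fin n → ℝ =>
      NormedSpace.exp (Matrix.of A) i j) hcont.continuousOn
    refine ⟨C, fun A hA => ?_⟩
    exact hC A (fun i _ j _ => abs_le.1 (hA i j))
  choose C hC using hb
  refine ⟨∑ i, ∑ j, |C i j|, ?_⟩
  filter_upwards [hK] with ω h1 i j
  refine (hC i j _ h1).trans ((le_abs_self _).trans ?_)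
  refine le_trans ?_ (Finset.single_le_sum (f := fun i => ∑ j, |C i j|)
    (fun i _ => Finset.sum_nonneg fun j _ => abs_nonneg _) (Finset.mem_univ i))
  exact Finset.single_le_sum (f := fun j => |C i j|) (fun j _ => abs_nonneg _) (Finset.mem_univ j)

include hanorm in
lemma Xp_AEB (s : ℕ) : AEB μ (Xp μ ℱ a s) := by
  refine AEB.sub μ ⟨amax ^ 2, ?_⟩ ⟨amax ^ 2, ?_⟩
  · refine ae_all_iff.2 fun i => ae_all_iff.2 fun j => ?_
    have := ae_bdd_abs_condExp_of_ae_bdd_abs (m := ℱ (s - 1)) (R := amax ^ 2)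
      (prod_bound μ a amax hanorm s i j)
    exact this
  · exact ae_all_iff.2 fun i => ae_all_iff.2 fun j => prod_bound μ a amax hanorm s i j

include hanorm in
lemma Hp_AEB (α β : ℝ) (t : ℕ) : AEB μ (Hp μ ℱ a α β t) :=
  AEB.sum μ _ fun s => AEB.sub μ (AEB.smul μ (Xp_AEB μ ℱ a amax hanorm s) _)
    (AEB.smul μ (AEB.sq μ (Xp_AEB μ ℱ a amax hanorm s)) _)

lemma sm_matrix {m : MeasurableSpace Ω} {f : Ω → Matrix (Fin n) (Fin n) ℝ}
    (hf : ∀ i j, StronglyMeasurable[m] (fun ω => f ω i j)) : StronglyMeasurable[m] f := by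
  let g : Ω → Fin n → Fin n → ℝ := f
  have : Measurable[m] g :=
    measurable_pi_iff.2 fun i => measurable_pi_iff.2 fun j => (hf i j).measurable
  have h2 : StronglyMeasurable[m] g := this.stronglyMeasurable
  exact h2

include hameas in
omit [IsProbabilityMeasure μ] in
lemma Xp_sm (s : ℕ) : StronglyMeasurable[ℱ s] (Xp μ ℱ a s) := by
  apply sm_matrix
  intro i j
  exact (stronglyMeasurable_condExp.mono (ℱ.mono (Nat.sub_le s 1))).sub (prod_meas ℱ a hameas s i j)

include hameas in
omit [IsProbabilityMeasure μ] in
lemma Hp_sm (α β : ℝ) (t : ℕ) : StronglyMeasurable[ℱ t] (Hp μ ℱ a α β t) := by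
  have : Hp μ ℱ a α β t = ∑ s ∈ Finset.Icc 1 t, fun ω => (α • Xp μ ℱ a s ω - β • Xp μ ℱ a s ω ^ 2) := by
    funext ω; rw [Finset.sum_apply]; rfl
  rw [this]
  refine Finset.stronglyMeasurable_sum _ fun s hs => ?_
  have h1 : StronglyMeasurable[ℱ t] (Xp μ ℱ a s) :=
    (Xp_sm μ ℱ a hameas s).mono (ℱ.mono (Finset.mem_Icc.1 hs).2)
  exact (h1.const_smul α).sub ((h1.pow 2).const_smul β)

end Proc

section Super
variable {n : ℕ} {Ω : Type*} {mΩ : MeasurableSpace Ω}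
  (μ : Measure Ω) [IsProbabilityMeasure μ] (ℱ : Filtration ℕ mΩ)
  (a : ℕ → Ω → EuclideanSpace ℝ (Fin n))

lemma Mp_int (hameas : ∀ s, StronglyMeasurable[ℱ s] (a s)) (amax : ℝ)
    (hanorm : ∀ s, ∀ᵐ ω ∂μ, ‖a s ω‖ ≤ amax) (α β : ℝ) (t : ℕ) :
    Integrable (fun ω => (NormedSpace.exp (Hp μ ℱ a α β t ω)).trace) μ := by
  obtain ⟨K, hK⟩ := AEB.exp μ (Hp_AEB μ ℱ a amax hanorm α β t)
  have hsm : StronglyMeasurable[ℱ t] (fun ω => (NormedSpace.exp (Hp μ ℱ a α β t ω)).trace) :=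
    (Continuous.matrix_trace exp_cont).comp_stronglyMeasurable (Hp_sm μ ℱ a hameas α β t)
  refine Integrable.of_bound (hsm.mono (ℱ.le t)).aestronglyMeasurable (∑ _i : Fin n, K) ?_
  filter_upwards [hK] with ω h
  rw [Real.norm_eq_abs, Matrix.trace]
  exact (Finset.abs_sum_le_sum_abs _ _).trans (Finset.sum_le_sum fun i _ => h i i)

lemma Mp_super [NeZero n] (hameas : ∀ s, StronglyMeasurable[ℱ s] (a s)) (amax : ℝ) (hamax : 0 < amax)
    (hanorm : ∀ s, ∀ᵐ ω ∂μ, ‖a s ω‖ ≤ amax) (θ : ℝ) (h0 : 0 < θ) (h1 : θ < 1) (α β : ℝ)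
    (hα : α = θ / amax ^ 2) (hβ : β = (-θ - Real.log (1 - θ)) / (amax ^ 2) ^ 2) (t : ℕ) (S : Set Ω)
    (hS : MeasurableSet[ℱ t] S) :
    ∫ ω in S, (NormedSpace.exp (Hp μ ℱ a α β (t + 1) ω)).trace ∂μ ≤
      ∫ ω in S, (NormedSpace.exp (Hp μ ℱ a α β t ω)).trace ∂μ := by
  obtain ⟨K, hK⟩ := AEB.exp μ (Hp_AEB μ ℱ a amax hanorm α β t)
  have hsm : StronglyMeasurable[ℱ t] (fun ω => (NormedSpace.exp (Hp μ ℱ a α β t ω))) :=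
    exp_cont.comp_stronglyMeasurable (Hp_sm μ ℱ a hameas α β t)
  have hent : ∀ i j, Integrable (fun ω => NormedSpace.exp (Hp μ ℱ a α β t ω) i j * Xp μ ℱ a (t + 1) ω j i) μ ∧
      ∫ ω in S, NormedSpace.exp (Hp μ ℱ a α β t ω) i j * Xp μ ℱ a (t + 1) ω j i ∂μ = 0 := by
    intro i j
    have hg : StronglyMeasurable[ℱ t] (fun ω => (NormedSpace.exp (Hp μ ℱ a α β t ω)) i j) :=
      (Continuous.matrix_elem continuous_id i j).comp_stronglyMeasurable hsm
    exact setIntegral_mul_condExp_sub μ (ℱ.le t) _ (fun ω' => a (t + 1) ω' j * a (t + 1) ω' i) hg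
      (hK.mono fun ω h => h i j) (prod_int μ ℱ a hameas amax hanorm (t + 1) j i) S hS
  have hint0 := Mp_int μ ℱ a hameas amax hanorm α β t
  have hint1 := Mp_int μ ℱ a hameas amax hanorm α β (t + 1)
  have hsi : Integrable (fun ω => ∑ i, ∑ j, NormedSpace.exp (Hp μ ℱ a α β t ω) i j * Xp μ ℱ a (t + 1) ω j i) μ :=
    integrable_finsetSum _ fun i _ => integrable_finsetSum _ fun j _ => (hent i j).1
  have hle : ∀ᵐ ω ∂μ, (NormedSpace.exp (Hp μ ℱ a α β (t + 1) ω)).trace ≤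
      (NormedSpace.exp (Hp μ ℱ a α β t ω)).trace +
        α * ∑ i, ∑ j, NormedSpace.exp (Hp μ ℱ a α β t ω) i j * Xp μ ℱ a (t + 1) ω j i := by
    filter_upwards [Xp_lower μ ℱ a hameas amax hanorm (t + 1)] with ω hω
    have e : Hp μ ℱ a α β (t + 1) ω = Hp μ ℱ a α β t ω +
        (α • Xp μ ℱ a (t + 1) ω - β • Xp μ ℱ a (t + 1) ω ^ 2) := by
      rw [Hp, Finset.sum_Icc_succ_top (by omega)]; rfl
    rw [e]
    have := trace_step (Hp μ ℱ a α β t ω) (Xp μ ℱ a (t + 1) ω) (Hp_symm μ ℱ a α β t ω)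
      (Xp_symm μ ℱ a (t + 1) ω) (by positivity : 0 < amax ^ 2) h0 h1 hω
    rw [← hα, ← hβ] at this
    refine this.trans (le_of_eq ?_)
    rw [Matrix.mul_add, Matrix.mul_one, Matrix.trace_add, Matrix.mul_smul, Matrix.trace_smul, smul_eq_mul]
    simp only [Matrix.trace, Matrix.diag, Matrix.mul_apply]
  calc _ ≤ ∫ ω in S, ((NormedSpace.exp (Hp μ ℱ a α β t ω)).trace +
        α * ∑ i, ∑ j, NormedSpace.exp (Hp μ ℱ a α β t ω) i j * Xp μ ℱ a (t + 1) ω j i) ∂μ :=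
        setIntegral_mono_ae hint1.integrableOn (hint0.add (hsi.const_mul α)).integrableOn hle
    _ = _ := by
      rw [integral_add hint0.integrableOn (hsi.const_mul α).integrableOn, integral_const_mul,
        integral_finsetSum _ (fun i _ => (integrable_finsetSum _ fun j _ => (hent i j).1).integrableOn)]
      rw [Finset.sum_eq_zero, mul_zero, add_zero]
      intro i _
      rw [integral_finsetSum _ (fun j _ => (hent i j).1.integrableOn)]
      exact Finset.sum_eq_zero fun j _ => (hent i j).2

lemma Mp_maximal [NeZero n] (hameas : ∀ s, StronglyMeasurable[ℱ s] (a s)) (amax : ℝ) (hamax : 0 < amax)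
    (hanorm : ∀ s, ∀ᵐ ω ∂μ, ‖a s ω‖ ≤ amax) (θ : ℝ) (h0 : 0 < θ) (h1 : θ < 1) (α β : ℝ)
    (hα : α = θ / amax ^ 2) (hβ : β = (-θ - Real.log (1 - θ)) / (amax ^ 2) ^ 2) (c : ℝ) (T : ℕ) :
    c * μ.real {ω | ∃ t, t ≤ T ∧ c ≤ (NormedSpace.exp (Hp μ ℱ a α β t ω)).trace} ≤ n := by
  have := maximal_super μ ℱ (fun t ω => (NormedSpace.exp (Hp μ ℱ a α β t ω)).trace)
    (fun t => (Continuous.matrix_trace exp_cont).comp_stronglyMeasurable (Hp_sm μ ℱ a hameas α β t))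
    (Mp_int μ ℱ a hameas amax hanorm α β)
    (fun t ω => trace_exp_nonneg _ (Hp_symm μ ℱ a α β t ω))
    (Mp_super μ ℱ a hameas amax hamax hanorm θ h0 h1 α β hα hβ) c T
  refine this.trans (le_of_eq ?_)
  simp [Hp]

lemma quad_le_specNorm (A : Matrix (Fin n) (Fin n) ℝ) (v : Fin n → ℝ) (hv : ∑ i, v i ^ 2 = 1) :
    v ⬝ᵥ A.mulVec v ≤ specNorm A := by
  set w : EuclideanSpace ℝ (Fin n) := WithLp.toLp 2 v
  have hw : ‖w‖ = 1 := by
    have := EuclideanSpace.real_norm_sq_eq w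
    have h2 : ‖w‖ ^ 2 = 1 := by rw [this]; exact hv
    nlinarith [norm_nonneg w]
  have h1 := real_inner_le_norm w (Matrix.toEuclideanCLM (𝕜 := ℝ) A w)
  have h2 := (Matrix.toEuclideanCLM (𝕜 := ℝ) A).le_opNorm w
  rw [hw, one_mul] at h1
  rw [hw, mul_one] at h2
  have e : inner ℝ w (Matrix.toEuclideanCLM (𝕜 := ℝ) A w) = v ⬝ᵥ A.mulVec v := by
    rw [PiLp.inner_apply]
    simp [w, dotProduct, mul_comm]
  rw [e] at h1
  exact h1.trans h2

/-- deterministic part: on the event, the trace exponential is large -/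
lemma det_part [NeZero n] (α β c₂ ψ W : ℝ) (hα : 0 ≤ α) (hβ : 0 ≤ β) (t : ℕ) (ω : Ω)
    (hpsd : ∀ s, ∀ v : Fin n → ℝ, 0 ≤ v ⬝ᵥ (cE μ ℱ a s ω).mulVec v)
    (hi : 2 * ψ - c₂ ≤ ∑ s ∈ Finset.Icc 1 t, lamMin (cE μ ℱ a s ω))
    (hii : specNorm (∑ s ∈ Finset.Icc 1 t, (Xp μ ℱ a s ω) ^ 2) ≤ W)
    (hev : lamMin (c₂ • (1 : Matrix (Fin n) (Fin n) ℝ) +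
          ∑ s ∈ Finset.Icc 1 t, outerMat (a s ω)) ≤ ψ) :
    Real.exp (α * ψ - β * W) ≤ (NormedSpace.exp (Hp μ ℱ a α β t ω)).trace := by
  have key : ∀ ε > 0, Real.exp (α * (ψ - ε) - β * W) ≤ (NormedSpace.exp (Hp μ ℱ a α β t ω)).trace := by
    intro ε hε
    have : Nonempty {v : Fin n → ℝ // ∑ i, (v i) ^ 2 = 1} :=
      ⟨⟨Pi.single 0 1, by simp [Pi.single_apply]⟩⟩
    have hlt : lamMin (c₂ • (1 : Matrix (Fin n) (Fin n) ℝ) +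
          ∑ s ∈ Finset.Icc 1 t, outerMat (a s ω)) < ψ + ε := by linarith
    obtain ⟨⟨v, hv⟩, hvlt⟩ := exists_lt_of_ciInf_lt hlt
    refine le_trans (Real.exp_le_exp.2 ?_) (exp_quad_le_trace_exp _ (Hp_symm μ ℱ a α β t ω) v hv)
    have hvv : v ⬝ᵥ v = 1 := by rw [← hv]; simp [dotProduct, pow_two]
    simp only [Matrix.add_mulVec, Matrix.smul_mulVec, Matrix.one_mulVec, dotProduct_add, dotProduct_smul,
      hvv, smul_eq_mul, mul_one, Matrix.sum_mulVec, dotProduct_sum] at hvlt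
    have h1 : ∑ s ∈ Finset.Icc 1 t, lamMin (cE μ ℱ a s ω) ≤
        ∑ s ∈ Finset.Icc 1 t, v ⬝ᵥ (cE μ ℱ a s ω).mulVec v := by
      refine Finset.sum_le_sum fun s _ => ?_
      exact ciInf_le (f := fun v : {v : Fin n → ℝ // ∑ i, (v i) ^ 2 = 1} => v.1 ⬝ᵥ (cE μ ℱ a s ω).mulVec v.1)
        ⟨0, by rintro _ ⟨v, rfl⟩; exact hpsd s v.1⟩ ⟨v, hv⟩
    have h2 := (quad_le_specNorm _ v hv).trans hii
    rw [Matrix.sum_mulVec, dotProduct_sum] at h2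
    have e : v ⬝ᵥ (Hp μ ℱ a α β t ω).mulVec v =
        α * (∑ s ∈ Finset.Icc 1 t, v ⬝ᵥ (cE μ ℱ a s ω).mulVec v -
          ∑ s ∈ Finset.Icc 1 t, v ⬝ᵥ (outerMat (a s ω)).mulVec v)
        - β * ∑ s ∈ Finset.Icc 1 t, v ⬝ᵥ (Xp μ ℱ a s ω ^ 2).mulVec v := by
      rw [Hp, Matrix.sum_mulVec, dotProduct_sum, ← Finset.sum_sub_distrib, Finset.mul_sum, Finset.mul_sum,
        ← Finset.sum_sub_distrib]
      refine Finset.sum_congr rfl fun s _ => ?_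
      rw [Matrix.sub_mulVec, dotProduct_sub, Matrix.smul_mulVec, Matrix.smul_mulVec, dotProduct_smul,
        dotProduct_smul, smul_eq_mul, smul_eq_mul, ← dotProduct_sub, ← Matrix.sub_mulVec]
      rfl
    rw [e]
    have h3 := mul_le_mul_of_nonneg_left h2 hβ
    have h4 : ψ - ε ≤ ∑ s ∈ Finset.Icc 1 t, v ⬝ᵥ (cE μ ℱ a s ω).mulVec v -
          ∑ s ∈ Finset.Icc 1 t, v ⬝ᵥ (outerMat (a s ω)).mulVec v := by linarith
    have h5 := mul_le_mul_of_nonneg_left h4 hα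
    linarith
  have hc : Filter.Tendsto (fun ε : ℝ => Real.exp (α * (ψ - ε) - β * W)) (nhdsWithin 0 (Set.Ioi 0))
      (nhds (Real.exp (α * (ψ - 0) - β * W))) := by
    apply Filter.Tendsto.mono_left _ nhdsWithin_le_nhds
    apply Continuous.tendsto
    fun_prop
  rw [sub_zero] at hc
  exact le_of_tendsto hc (by filter_upwards [self_mem_nhdsWithin] with ε hε using key ε hε)

end Super

/-- high-probability lower bound on `λ_min(V_t)`. Under the TRAiL-type
conditions (i) (summed conditional minimum-eigenvalue lower bound) and (ii)
(quadratic-variation bound), with `V_t = λI + ∑_{s≤t} a_s a_sᵀ`, `λ = c₂`, the probability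
that `λ_min(V_t) ≤ (Dc₀/2)√t` for some `t ∈ [F(δ), T]` is at most `δ/3`. -/
theorem lamMin_design_matrix_high_prob {n : ℕ} {Ω : Type*} {mΩ : MeasurableSpace Ω}
    (μ : Measure Ω) [IsProbabilityMeasure μ]
    (ℱ : Filtration ℕ mΩ)
    (a : ℕ → Ω → EuclideanSpace ℝ (Fin n))
    (hameas : ∀ s, StronglyMeasurable[ℱ s] (a s))
    (amax D c₀ mbarφ : ℝ)
    (hamax : 0 < amax) (hD : 0 < D) (hc₀ : 0 < c₀) (hmbarφ : 0 < mbarφ)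
    (hanorm : ∀ s, ∀ᵐ ω ∂μ, ‖a s ω‖ ≤ amax)
    (c₂ reg C : ℝ) (ψ : ℕ → ℝ)
    (hc₂ : c₂ = 8 * n * D ^ 2 / mbarφ ^ 2 * (c₀ * n + 1))
    (hreg : reg = c₂)
    (hCdef : C = 256 * amax ^ 2 * n / c₀)
    (hψ : ∀ t : ℕ, ψ t = D * c₀ / 2 * Real.sqrt t)
    -- (i): lower bound on the summed conditional minimum eigenvalues
    (hi : ∀ᵐ ω ∂μ, ∀ t : ℕ, 1 ≤ t →
      D * c₀ * Real.sqrt t - c₂ ≤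
        ∑ s ∈ Finset.Icc 1 t, lamMin (Matrix.of fun i j =>
          (μ[(fun ω' => a s ω' i * a s ω' j) | ℱ (s - 1)]) ω))
    -- (ii): quadratic-variation bound
    (hii : ∀ᵐ ω ∂μ, ∀ t : ℕ, 1 ≤ t →
      specNorm (∑ s ∈ Finset.Icc 1 t,
        ((Matrix.of fun i j => (μ[(fun ω' => a s ω' i * a s ω' j) | ℱ (s - 1)]) ω) -
          outerMat (a s ω)) ^ 2) ≤ C * ψ t)
    (F : ℝ → ℝ)
    (hF : ∀ δ : ℝ, F δ = 16 * amax ^ 4 / (9 * D ^ 2 * c₀ ^ 2) *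
      (Real.log (3 * n / δ)) ^ 2 * (768 * n / c₀ + 2) ^ 2)
    (δ : ℝ) (hδ0 : 0 < δ) (hδ1 : δ < 1) (T : ℕ) (hT : F δ ≤ T) :
    μ {ω | ∃ t : ℕ, F δ ≤ t ∧ t ≤ T ∧
        lamMin (reg • (1 : Matrix (Fin n) (Fin n) ℝ) +
          ∑ s ∈ Finset.Icc 1 t, outerMat (a s ω)) ≤ D * c₀ / 2 * Real.sqrt t}
      ≤ ENNReal.ofReal (δ / 3) := by
  rcases Nat.eq_zero_or_pos n with hn0 | hnpos
  · exfalso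
    subst hn0
    have hem : IsEmpty {v : Fin 0 → ℝ // ∑ i, (v i) ^ 2 = 1} := ⟨fun v => by have := v.2; simp at this⟩
    obtain ⟨ω, hω⟩ := hi.exists
    have h1 := hω 1 le_rfl
    simp only [lamMin, Real.iInf_of_isEmpty, hc₂] at h1
    simp at h1
    nlinarith [mul_pos hD hc₀]
  have : NeZero n := ⟨hnpos.ne'⟩
  have hnR : (1 : ℝ) ≤ n := by exact_mod_cast hnpos
  have hn0 : (0 : ℝ) < n := by linarith
  set x : ℝ := 256 * n / c₀ with hx
  have hx0 : 0 < x := by positivity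
  set θ : ℝ := 1 / (1 + x) with hθ
  have hθ0 : 0 < θ := by positivity
  have hθ1 : θ < 1 := by rw [hθ, div_lt_one (by positivity)]; linarith
  set g : ℝ := -θ - Real.log (1 - θ) with hg
  have hg0 : 0 ≤ g := by
    have := Real.log_le_sub_one_of_pos (show 0 < 1 - θ by linarith)
    rw [hg]; linarith
  have hexp := exponent_bound hx0
  rw [← hθ, ← hg] at hexp
  set α : ℝ := θ / amax ^ 2 with hα
  set β : ℝ := g / (amax ^ 2) ^ 2 with hβ
  set L : ℝ := Real.log (3 * n / δ) with hL
  have hc1 : 1 < 3 * n / δ := by rw [lt_div_iff₀ hδ0]; linarith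
  have hL0 : 0 < L := Real.log_pos hc1
  have hmax := Mp_maximal μ ℱ a hameas amax hamax hanorm θ hθ0 hθ1 α β hα hβ (3 * n / δ) T
  have hF0 : F δ = (4 * amax ^ 2 / (3 * D * c₀) * L * (3 * x + 2)) ^ 2 := by
    rw [hF, hx]; field_simp; ring
  have hmain : ∀ t : ℕ, F δ ≤ t → 3 * n / δ ≤ Real.exp (α * ψ t - β * (C * ψ t)) := by
    intro t ht
    rw [hF0] at ht
    have h1 : 4 * amax ^ 2 / (3 * D * c₀) * L * (3 * x + 2) ≤ Real.sqrt t := Real.le_sqrt_of_sq_le ht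
    have h2 : 2 / 3 * amax ^ 2 * L * (3 * x + 2) ≤ ψ t := by
      rw [hψ]
      calc _ = D * c₀ / 2 * (4 * amax ^ 2 / (3 * D * c₀) * L * (3 * x + 2)) := by field_simp; ring
        _ ≤ _ := by gcongr
    have hC : C = x * amax ^ 2 := by rw [hCdef, hx]; ring
    have e : α * ψ t - β * (C * ψ t) = ψ t / amax ^ 2 * (θ - g * x) := by
      rw [hC, hα, hβ]; field_simp
    have hψ0 : 0 ≤ ψ t := by rw [hψ]; positivity
    have h3 : L ≤ α * ψ t - β * (C * ψ t) := by
      rw [e]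
      calc L = (2 / 3 * amax ^ 2 * L * (3 * x + 2)) / amax ^ 2 * (1 / (2 * (x + 2 / 3))) := by
            field_simp
        _ ≤ _ := by gcongr
    calc 3 * n / δ = Real.exp L := by rw [hL, Real.exp_log (by positivity)]
      _ ≤ _ := Real.exp_le_exp.2 h3
  have hsub : μ {ω | ∃ t : ℕ, F δ ≤ t ∧ t ≤ T ∧
        lamMin (reg • (1 : Matrix (Fin n) (Fin n) ℝ) +
          ∑ s ∈ Finset.Icc 1 t, outerMat (a s ω)) ≤ D * c₀ / 2 * Real.sqrt t} ≤
      μ {ω | ∃ t, t ≤ T ∧ 3 * n / δ ≤ (NormedSpace.exp (Hp μ ℱ a α β t ω)).trace} := by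
    apply measure_mono_ae
    filter_upwards [hi, hii, ae_all_iff.2 (cE_psd μ ℱ a hameas amax hanorm)] with ω h1 h2 h3
    rintro ⟨t, ht1, ht2, ht3⟩
    have ht : 1 ≤ t := by
      rcases Nat.eq_zero_or_pos t with h | h
      · exfalso
        subst h
        have : 0 < F δ := by rw [hF0]; positivity
        simp at ht1
        linarith
      · exact h
    refine ⟨t, ht2, (hmain t ht1).trans ?_⟩
    rw [hreg, ← hψ] at ht3
    refine det_part μ ℱ a α β c₂ (ψ t) (C * ψ t) (by positivity) (by positivity) t ω h3 ?_ (h2 t ht) ht3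
    have := h1 t ht
    rw [hψ]
    refine le_trans (le_of_eq ?_) this
    ring
  refine hsub.trans ?_
  rw [← ENNReal.ofReal_toReal (measure_ne_top μ _)]
  apply ENNReal.ofReal_le_ofReal
  change μ.real _ ≤ _
  rw [div_mul_eq_mul_div, div_le_iff₀ hδ0] at hmax
  have h3 : 3 * (n:ℝ) * μ.real {ω | ∃ t, t ≤ T ∧ 3 * n / δ ≤ (NormedSpace.exp (Hp μ ℱ a α β t ω)).trace}
      ≤ 3 * n * (δ / 3) := by linarith
  exact le_of_mul_le_mul_left h3 (by positivity)
end

section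
/- Let n ≥ 2, let ℓ = (ℓ₁, …, ℓₙ) ∈ ℝⁿ, and let v > 0 satisfy v ≤ 4ℓ₁² − 2‖ℓ‖². Let M = ℓℓᵀ + diag(0, v, v, …, v) be the n×n symmetric matrix obtained by adding the rank-one matrix ℓℓᵀ to the diagonal matrix whose first diagonal entry is 0 and whose remaining n−1 diagonal entries equal v. Then the smallest eigenvalue of M satisfies λ_min(M) ≥ v/2. -/
open Matrix

lemma le_of_sq_le_sq_aux {x y : ℝ} (hy : 0 ≤ y) (h : x ^ 2 ≤ y ^ 2) : x ≤ y :=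
  (abs_le_of_sq_le_sq' h hy).2

lemma lorentz_aux (a b p Q s w : ℝ) (hb : 0 ≤ b) (hQ : 0 ≤ Q) (hs : s ^ 2 ≤ Q * b)
    (hw : 0 < w) (h : w ≤ p ^ 2 - Q) : 0 ≤ (p * a + s) ^ 2 + w * b - w * a ^ 2 := by
  rcases le_total (a ^ 2) b with hab | hab
  · nlinarith [sq_nonneg (p * a + s), mul_le_mul_of_nonneg_left hab hw.le]
  · have h1 : w * (a ^ 2 - b) ≤ (p ^ 2 - Q) * (a ^ 2 - b) :=
      mul_le_mul_of_nonneg_right h (by linarith)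
    set q := √Q with hq
    set c := √b with hc
    have hqQ : q ^ 2 = Q := Real.sq_sqrt hQ
    have hcb : c ^ 2 = b := Real.sq_sqrt hb
    have hq0 : 0 ≤ q := Real.sqrt_nonneg _
    have hc0 : 0 ≤ c := Real.sqrt_nonneg _
    have hst : |s| ≤ q * c := abs_le_of_sq_le_sq (by rw [mul_pow, hqQ, hcb]; exact hs)
      (by positivity)
    have hqp : q ≤ |p| := by
      apply le_of_sq_le_sq_aux (abs_nonneg _); rw [sq_abs, hqQ]; linarith
    have hca : c ≤ |a| := by
      apply le_of_sq_le_sq_aux (abs_nonneg _); rw [sq_abs, hcb]; linarith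
    have hm : q * c ≤ |p| * |a| := mul_le_mul hqp hca hc0 (abs_nonneg _)
    have h2 : |p| * |a| - q * c ≤ |p * a + s| := by
      have := abs_sub_abs_le_abs_sub (p * a) (-s)
      rw [abs_neg, abs_mul, sub_neg_eq_add] at this
      linarith
    have h3 : (|p| * |a| - q * c) ^ 2 ≤ (p * a + s) ^ 2 := by
      rw [← sq_abs (p * a + s)]
      exact pow_le_pow_left₀ (by linarith) h2 2
    have h4 := sq_nonneg (|p| * c - q * |a|)
    have h5 : (|p| ^ 2 - q ^ 2) * (|a| ^ 2 - c ^ 2) =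
      (|p| * |a| - q * c) ^ 2 - (|p| * c - q * |a|) ^ 2 := by ring
    rw [sq_abs, sq_abs, hqQ, hcb] at h5
    linarith

/-- If `0 < v ≤ 4ℓ₁² − 2‖ℓ‖²`, the smallest eigenvalue of
`ℓℓᵀ + diag(0, v, …, v)` is at least `v/2`. -/
theorem lamMin_rank_one_update {n : ℕ} (hn : 2 ≤ n)
    (ℓ : Fin n → ℝ) (v : ℝ) (hv : 0 < v)
    (hvle : v ≤ 4 * (ℓ ⟨0, by omega⟩) ^ 2 - 2 * ∑ i, (ℓ i) ^ 2)
    (M : Matrix (Fin n) (Fin n) ℝ)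
    (hM : M = Matrix.vecMulVec ℓ ℓ +
      Matrix.diagonal (fun i => if i = (⟨0, by omega⟩ : Fin n) then 0 else v)) :
    v / 2 ≤ lamMin M := by
  obtain ⟨m, rfl⟩ : ∃ m, n = m + 1 := ⟨n - 1, by omega⟩
  have h0 : (⟨0, by omega⟩ : Fin (m + 1)) = 0 := rfl
  rw [h0] at hvle hM
  haveI : Nonempty {v : Fin (m + 1) → ℝ // ∑ i, (v i) ^ 2 = 1} :=
    ⟨⟨Pi.single 0 1, by simp [Fin.sum_univ_succ]⟩⟩
  unfold lamMin
  refine le_ciInf ?_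
  rintro ⟨x, hx⟩
  have key : x ⬝ᵥ M.mulVec x = (∑ i, ℓ i * x i) ^ 2 + v * ∑ i : Fin m, x i.succ ^ 2 := by
    rw [hM, Matrix.add_mulVec, dotProduct_add]
    congr 1
    · simp only [Matrix.vecMulVec_mulVec, dotProduct, Pi.smul_apply]
      simp only [MulOpposite.smul_eq_mul_unop, MulOpposite.unop_op, sq, Finset.sum_mul]
      refine Finset.sum_congr rfl fun i _ => by ring
    · simp only [dotProduct, Matrix.mulVec_diagonal, Fin.sum_univ_succ, Finset.mul_sum]
      simp only [if_true, zero_mul, mul_zero, zero_add, Fin.succ_ne_zero, if_false]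
      refine Finset.sum_congr rfl fun i _ => by ring
  simp only [key]
  rw [Fin.sum_univ_succ] at hx hvle ⊢
  have hcs := Finset.sum_mul_sq_le_sq_mul_sq Finset.univ
    (fun i : Fin m => ℓ i.succ) (fun i => x i.succ)
  have := lorentz_aux (x 0) (∑ i : Fin m, x i.succ ^ 2) (ℓ 0) (∑ i : Fin m, ℓ i.succ ^ 2)
    (∑ i : Fin m, ℓ i.succ * x i.succ) (v / 2) (Finset.sum_nonneg fun i _ => sq_nonneg _)
    (Finset.sum_nonneg fun i _ => sq_nonneg _) hcs (by linarith) (by linarith)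
  have hx2 : x 0 ^ 2 = 1 - ∑ i : Fin m, x i.succ ^ 2 := by linarith
  rw [hx2] at this
  linarith
end
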